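/- Let λ > 0, let 0 < δ < 1, and let M be a Poisson(λ) random variable. Then E[ 1/(M + δ) ] ≤ (1 − e^{−λ}) / (λ·δ). -/

import Mathlib

theorem hasSum_pow_div_factorial_succ {x : ℝ} (hx : x ≠ 0) :
    HasSum (fun n : ℕ ↦ x ^ n / (n + 1).factorial) ((Real.exp x - 1) / x) := by
  have h : HasSum (fun n : ℕ ↦ x ^ n / n.factorial) (Real.exp x) := by
    rw [Real.exp_eq_exp_ℝ]
    exact NormedSpace.expSeries_div_hasSum_exp x
  have h' := ((hasSum_nat_add_iff' 1).mpr h).div_const x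
  simp only [Finset.sum_range_one, pow_zero, Nat.factorial_zero, Nat.cast_one, div_one] at h'
  refine h'.congr_fun fun n ↦ ?_
  field_simp
  ring

/-- For a Poisson(λ) random variable `M` and `0 < δ < 1`,
`E[1/(M+δ)] ≤ (1 - e^{-λ})/(λ δ)`. -/
theorem stmt_7 (lam : ℝ) (hlam : 0 < lam) (δ : ℝ) (hδ0 : 0 < δ) (hδ1 : δ < 1) :
    ∑' n : ℕ, lam ^ n * Real.exp (-lam) / n.factorial * (1 / (n + δ))
      ≤ (1 - Real.exp (-lam)) / (lam * δ) := by
  have hsum : HasSum (fun n : ℕ ↦ lam ^ n / (n + 1).factorial * (Real.exp (-lam) / δ))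
      ((1 - Real.exp (-lam)) / (lam * δ)) := by
    have h := (hasSum_pow_div_factorial_succ hlam.ne').mul_right (Real.exp (-lam) / δ)
    rwa [div_mul_div_comm, sub_mul, ← Real.exp_add, add_neg_cancel, Real.exp_zero, one_mul] at h
  have hle : ∀ n : ℕ, lam ^ n * Real.exp (-lam) / n.factorial * (1 / (n + δ))
      ≤ lam ^ n / (n + 1).factorial * (Real.exp (-lam) / δ) := by
    intro n
    have hn : (0 : ℝ) ≤ n := n.cast_nonneg
    have hrecip : 1 / (n + δ) ≤ 1 / ((n + 1) * δ) :=
      one_div_le_one_div_of_le (by positivity) (by nlinarith)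
    calc lam ^ n * Real.exp (-lam) / n.factorial * (1 / (n + δ))
        ≤ lam ^ n * Real.exp (-lam) / n.factorial * (1 / ((n + 1) * δ)) := by gcongr
      _ = lam ^ n / (n + 1).factorial * (Real.exp (-lam) / δ) := by
        rw [Nat.factorial_succ]
        push_cast
        field_simp
  rw [← hsum.tsum_eq]
  exact (hsum.summable.of_nonneg_of_le (fun n ↦ by positivity) hle).tsum_le_tsum hle hsum.summable
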